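/- Let K' be the ideal of Q generated by τ_i² − τ·ξ_{i+1} for all i ≥ 0, together with ξ₁⁴, ξ₂², ξ_n for n ≥ 3, and τ_n for n ≥ 3. Then K' is a coideal for the motivic coproduct: ψ(K') ⊆ K' ⊗ Q + Q ⊗ K', and the counit vanishes on K'. (The quotient Q/K' is the motivic dual of A(2), namely R[τ₀, τ₁, τ₂, ξ₁, ξ₂]/(τ₀² − τξ₁, ξ₁⁴, τ₁² − τξ₂, ξ₂², τ₂²).) -/

import Mathlib

open MvPolynomial TensorProduct

noncomputable section

/-- The motivic ground ring `R = F₂[τ]`. -/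
abbrev R : Type := Polynomial (ZMod 2)

/-- The element `τ` of `R`. -/
def tR : R := Polynomial.X

/-- The polynomial `R`-algebra `Q = R[τ₀, τ₁, τ₂, …, ξ₁, ξ₂, …]`; the
variable `X (Sum.inl i)` represents `τᵢ`, and `X (Sum.inr n)` represents
`ξ_{n+1}`. -/
abbrev Q : Type := MvPolynomial (ℕ ⊕ ℕ) R

/-- The generator `τᵢ` of `Q`. -/
def tau (i : ℕ) : Q := X (Sum.inl i)

/-- The element `ξ_n` of `Q`, with the convention `ξ₀ = 1`. -/
def xi : ℕ → Q
  | 0 => 1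
  | n + 1 => X (Sum.inr n)

/-- The motivic coproduct `ψ : Q → Q ⊗ Q`, the unique `R`-algebra map with
`ψ(τᵢ) = τᵢ ⊗ 1 + Σ_{k=0}^{i} ξ_{i-k}^{2^k} ⊗ τ_k` and
`ψ(ξᵢ) = Σ_{k=0}^{i} ξ_{i-k}^{2^k} ⊗ ξ_k`. -/
def psi : Q →ₐ[R] Q ⊗[R] Q :=
  aeval fun g =>
    match g with
    | Sum.inl i =>
        (tau i) ⊗ₜ[R] (1 : Q) +
          ∑ k ∈ Finset.range (i + 1), ((xi (i - k)) ^ (2 ^ k)) ⊗ₜ[R] (tau k)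
    | Sum.inr n =>
        ∑ k ∈ Finset.range (n + 2), ((xi (n + 1 - k)) ^ (2 ^ k)) ⊗ₜ[R] (xi k)

/-- The counit `ε : Q → R`, the unique `R`-algebra map sending every
generator `τᵢ` and `ξᵢ` to `0`. -/
def eps : Q →ₐ[R] R :=
  aeval fun _ => 0

/-- The subspace `J ⊗ Q + Q ⊗ J` of `Q ⊗ Q` (equivalently, the ideal of
`Q ⊗ Q` generated by the images of `J` under the two inclusions). -/
def coidealSpan (J : Ideal Q) : Ideal (Q ⊗[R] Q) :=
  J.map (Algebra.TensorProduct.includeLeft : Q →ₐ[R] Q ⊗[R] Q) ⊔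
    J.map (Algebra.TensorProduct.includeRight : Q →ₐ[R] Q ⊗[R] Q)

/-- `A ⊗[R] A` (written so that the implicit module instances are the ones
derived from the algebra structure of `A`). -/
abbrev TSq (A : Type) [CommSemiring A] [Algebra R A] : Type := A ⊗[R] A

/-- The ideal `K'` of `Q` generated by `τᵢ² - τ·ξ_{i+1}` for all `i ≥ 0`,
together with `ξ₁⁴`, `ξ₂²`, the `ξ_n` for `n ≥ 3`, and the `τ_n` for
`n ≥ 3`; the quotient `Q/K'` is the motivic dual of `A(2)`, namely
`R[τ₀, τ₁, τ₂, ξ₁, ξ₂]/(τ₀² - τξ₁, ξ₁⁴, τ₁² - τξ₂, ξ₂², τ₂²)`. -/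
def K' : Ideal Q :=
  Ideal.span
    ({x | ∃ i, x = tau i ^ 2 - C tR * xi (i + 1)} ∪ {xi 1 ^ 4, xi 2 ^ 2} ∪
      {x | ∃ n, 3 ≤ n ∧ x = xi n} ∪ {x | ∃ n, 3 ≤ n ∧ x = tau n})

theorem tmul_mem_coidealSpan_left {J : Ideal Q} {a : Q} (ha : a ∈ J) (b : Q) :
    a ⊗ₜ[R] b ∈ coidealSpan J := by
  have h : a ⊗ₜ[R] (1 : Q) ∈ coidealSpan J := Ideal.mem_sup_left
    (Ideal.mem_map_of_mem (Algebra.TensorProduct.includeLeft : Q →ₐ[R] Q ⊗[R] Q) ha)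
  simpa using Ideal.mul_mem_left _ ((1 : Q) ⊗ₜ[R] b) h

theorem tmul_mem_coidealSpan_right {J : Ideal Q} (a : Q) {b : Q} (hb : b ∈ J) :
    a ⊗ₜ[R] b ∈ coidealSpan J := by
  have h : (1 : Q) ⊗ₜ[R] b ∈ coidealSpan J := Ideal.mem_sup_right
    (Ideal.mem_map_of_mem (Algebra.TensorProduct.includeRight : Q →ₐ[R] Q ⊗[R] Q) hb)
  simpa using Ideal.mul_mem_left _ (a ⊗ₜ[R] (1 : Q)) h

theorem psi_tau (i : ℕ) : psi (tau i) = tau i ⊗ₜ[R] (1 : Q) +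
    ∑ k ∈ Finset.range (i + 1), (xi (i - k) ^ 2 ^ k) ⊗ₜ[R] tau k := by
  rw [psi, tau, aeval_X]
  rfl

theorem psi_xi (n : ℕ) :
    psi (xi n) = ∑ k ∈ Finset.range (n + 1), (xi (n - k) ^ 2 ^ k) ⊗ₜ[R] xi k := by
  cases n with
  | zero => simp [xi, Algebra.TensorProduct.one_def]
  | succ n => rw [psi, xi, aeval_X]

theorem two_tmul_eq_zero : (2 : Q ⊗[R] Q) = 0 := by
  rw [← map_ofNat (algebraMap R (Q ⊗[R] Q)) 2, show (OfNat.ofNat 2 : R) = 0 from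
    CharTwo.two_eq_zero, map_zero]

theorem tmul_add_sq (x y : Q ⊗[R] Q) : (x + y) ^ 2 = x ^ 2 + y ^ 2 := by
  rw [add_sq, two_tmul_eq_zero, zero_mul, zero_mul, add_zero]

theorem tmul_sum_sq (s : Finset ℕ) (f : ℕ → Q ⊗[R] Q) :
    (∑ k ∈ s, f k) ^ 2 = ∑ k ∈ s, f k ^ 2 := by
  induction s using Finset.cons_induction with
  | empty => simp
  | cons a s ha ih => rw [Finset.sum_cons, Finset.sum_cons, tmul_add_sq, ih]

theorem tau_sq_sub_mem_K' (i : ℕ) : tau i ^ 2 - C tR * xi (i + 1) ∈ K' :=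
  Ideal.subset_span (Or.inl (Or.inl (Or.inl ⟨i, rfl⟩)))

theorem xi_one_pow_four_mem_K' : xi 1 ^ 4 ∈ K' :=
  Ideal.subset_span (Or.inl (Or.inl (Or.inr (Or.inl rfl))))

theorem xi_two_sq_mem_K' : xi 2 ^ 2 ∈ K' :=
  Ideal.subset_span (Or.inl (Or.inl (Or.inr (Or.inr rfl))))

theorem xi_mem_K' {n : ℕ} (hn : 3 ≤ n) : xi n ∈ K' :=
  Ideal.subset_span (Or.inl (Or.inr ⟨n, hn, rfl⟩))

theorem tau_mem_K' {n : ℕ} (hn : 3 ≤ n) : tau n ∈ K' :=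
  Ideal.subset_span (Or.inr ⟨n, hn, rfl⟩)

theorem xi_pow_mem_K' {m k : ℕ} (hm : 3 ≤ m + k) (hk : k < 3) : xi m ^ 2 ^ k ∈ K' := by
  by_cases h : 3 ≤ m
  · exact Ideal.pow_mem_of_mem _ (xi_mem_K' h) _ (by positivity)
  · have hcases : m = 1 ∧ k = 2 ∨ m = 2 ∧ k = 1 ∨ m = 2 ∧ k = 2 := by omega
    rcases hcases with ⟨rfl, rfl⟩ | ⟨rfl, rfl⟩ | ⟨rfl, rfl⟩
    · exact xi_one_pow_four_mem_K'
    · exact xi_two_sq_mem_K'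
    · exact Ideal.pow_mem_of_pow_mem K' xi_two_sq_mem_K' (by norm_num)

theorem sum_xi_pow_tmul_mem_coidealSpan {n : ℕ} (hn : 3 ≤ n) {f : ℕ → Q}
    (hf : ∀ k, 3 ≤ k → f k ∈ K') :
    ∑ k ∈ Finset.range (n + 1), (xi (n - k) ^ 2 ^ k) ⊗ₜ[R] f k ∈ coidealSpan K' := by
  refine Ideal.sum_mem _ fun k hk => ?_
  have hk' := Finset.mem_range.mp hk
  by_cases h : 3 ≤ k
  · exact tmul_mem_coidealSpan_right _ (hf k h)
  · exact tmul_mem_coidealSpan_left (xi_pow_mem_K' (by omega) (by omega)) _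

theorem tau_sq_sub_eq (i : ℕ) :
    tau i ^ 2 - C tR * xi (i + 1) = tau i ^ 2 + tR • xi (i + 1) := by
  rw [CharTwo.sub_eq_add, smul_eq_C_mul]

theorem psi_tau_sq_sub (i : ℕ) : psi (tau i ^ 2 - C tR * xi (i + 1)) =
    (tau i ^ 2 - C tR * xi (i + 1)) ⊗ₜ[R] (1 : Q) +
      ∑ k ∈ Finset.range (i + 1),
        (xi (i - k) ^ 2 ^ (k + 1)) ⊗ₜ[R] (tau k ^ 2 - C tR * xi (k + 1)) := by
  have hsq : psi (tau i ^ 2) = (tau i ^ 2) ⊗ₜ[R] (1 : Q) +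
      ∑ k ∈ Finset.range (i + 1), (xi (i - k) ^ 2 ^ (k + 1)) ⊗ₜ[R] (tau k ^ 2) := by
    simp only [map_pow, psi_tau, tmul_add_sq, tmul_sum_sq, Algebra.TensorProduct.tmul_pow,
      one_pow, ← pow_mul, ← pow_succ]
  have hxi : psi (xi (i + 1)) = xi (i + 1) ⊗ₜ[R] (1 : Q) +
      ∑ k ∈ Finset.range (i + 1), (xi (i - k) ^ 2 ^ (k + 1)) ⊗ₜ[R] xi (k + 1) := by
    rw [psi_xi, Finset.sum_range_succ', add_comm]
    simp only [Nat.add_sub_add_right, Nat.sub_zero, pow_zero, pow_one]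
    rfl
  simp only [tau_sq_sub_eq, map_add, map_smul, hsq, hxi, TensorProduct.add_tmul,
    TensorProduct.tmul_add, Finset.sum_add_distrib, smul_add, Finset.smul_sum]
  rw [add_add_add_comm]
  congr 2
  exact Finset.sum_congr rfl fun k _ => (TensorProduct.tmul_smul _ _ _).symm

theorem psi_xi_one_pow_four :
    psi (xi 1 ^ 4) = (xi 1 ^ 4) ⊗ₜ[R] (1 : Q) + (1 : Q) ⊗ₜ[R] (xi 1 ^ 4) := by
  rw [show 4 = 2 * 2 from rfl, pow_mul, map_pow, map_pow, psi_xi, tmul_sum_sq, tmul_sum_sq]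
  simp [Finset.sum_range_succ, Algebra.TensorProduct.tmul_pow, xi, ← pow_mul]

theorem psi_xi_two_sq :
    psi (xi 2 ^ 2) = (xi 2 ^ 2) ⊗ₜ[R] (1 : Q) + (xi 1 ^ 4) ⊗ₜ[R] (xi 1 ^ 2) +
      (1 : Q) ⊗ₜ[R] (xi 2 ^ 2) := by
  rw [map_pow, psi_xi, tmul_sum_sq]
  simp [Finset.sum_range_succ, Algebra.TensorProduct.tmul_pow, xi, ← pow_mul]

theorem eps_tau (i : ℕ) : eps (tau i) = 0 := by
  simp [eps, tau]

theorem eps_xi_succ (n : ℕ) : eps (xi (n + 1)) = 0 := by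
  simp [eps, xi]

theorem psi_mem_coidealSpan_K' {x : Q} (hx : x ∈ K') : psi x ∈ coidealSpan K' := by
  suffices h : K' ≤ (coidealSpan K').comap psi from h hx
  refine Ideal.span_le.mpr ?_
  rintro _ (((⟨i, rfl⟩ | rfl | rfl) | ⟨n, hn, rfl⟩) | ⟨n, hn, rfl⟩) <;>
    rw [SetLike.mem_coe, Ideal.mem_comap]
  · rw [psi_tau_sq_sub]
    exact add_mem (tmul_mem_coidealSpan_left (tau_sq_sub_mem_K' i) _)
      (Ideal.sum_mem _ fun k _ => tmul_mem_coidealSpan_right _ (tau_sq_sub_mem_K' k))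
  · rw [psi_xi_one_pow_four]
    exact add_mem (tmul_mem_coidealSpan_left xi_one_pow_four_mem_K' _)
      (tmul_mem_coidealSpan_right _ xi_one_pow_four_mem_K')
  · rw [psi_xi_two_sq]
    exact add_mem (add_mem (tmul_mem_coidealSpan_left xi_two_sq_mem_K' _)
      (tmul_mem_coidealSpan_left xi_one_pow_four_mem_K' _))
      (tmul_mem_coidealSpan_right _ xi_two_sq_mem_K')
  · rw [psi_xi]
    exact sum_xi_pow_tmul_mem_coidealSpan hn fun _ => xi_mem_K'
  · rw [psi_tau]
    exact add_mem (tmul_mem_coidealSpan_left (tau_mem_K' hn) _)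
      (sum_xi_pow_tmul_mem_coidealSpan hn fun _ => tau_mem_K')

theorem eps_eq_zero_of_mem_K' {x : Q} (hx : x ∈ K') : eps x = 0 := by
  suffices h : K' ≤ RingHom.ker eps from h hx
  refine Ideal.span_le.mpr ?_
  rintro _ (((⟨i, rfl⟩ | rfl | rfl) | ⟨n, hn, rfl⟩) | ⟨n, hn, rfl⟩) <;>
    rw [SetLike.mem_coe, RingHom.mem_ker]
  · simp [eps_tau, eps_xi_succ]
  · simp [eps_xi_succ 0]
  · simp [eps_xi_succ 1]
  · obtain ⟨m, rfl⟩ := Nat.exists_eq_add_of_le' (le_trans (by norm_num : 1 ≤ 3) hn)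
    exact eps_xi_succ m
  · exact eps_tau n

/-- The ideal `K'` is a coideal for the motivic coproduct:
`ψ(K') ⊆ K' ⊗ Q + Q ⊗ K'`, and the counit `ε` vanishes on `K'`. -/
theorem K'_is_coideal :
    (∀ x ∈ K', psi x ∈ coidealSpan K') ∧ (∀ x ∈ K', eps x = 0) := by
  exact ⟨fun _ => psi_mem_coidealSpan_K', fun _ => eps_eq_zero_of_mem_K'⟩

end
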